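/- arXiv:2604.26950 — 2 statements merged into one kernel-verified Lean document; each statement's English description precedes it below -/
import Mathlib

section
/- Let K be a field of characteristic zero, R = MvPowerSeries (Fin n) K, and φ a formal isotopy (a K-algebra automorphism of PowerSeries R with φ(t) = t), with components φ^{k,i} := coeff_k(φ(C(x^i))) ∈ R. Suppose: (1) for every k ≥ 1 and every i, coeff_α(φ^{k,i}) = 0 whenever |α| ≤ 1; (2) for every N ∈ ℕ there exists K₀ such that for all k ≥ K₀, all i, and all multi-indices α with |α| < N, coeff_α(φ^{k,i}) = 0. Then φ is evaluative: (a) for every i and every multi-index α, the set {k : coeff_α(φ^{k,i}) ≠ 0} is finite; (b) constantCoeff(φ^{k,i}) = 0 for all k and i; (c) the matrix p : Matrix (Fin n) (Fin n) (Polynomial K) with p i j := Σ_k coeff_{e_j}(φ^{k,i})·t^k (a polynomial by (a)) has determinant equal to a nonzero constant polynomial. -/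
namespace MvPowerSeries

theorem mem_span_image_X {σ R : Type*} [CommRing R] (s : Finset σ) (f : MvPowerSeries σ R)
    (hf : ∀ m : σ →₀ ℕ, (∀ i ∈ s, m i = 0) → coeff m f = 0) :
    f ∈ Ideal.span ((X : σ → MvPowerSeries σ R) '' s) := by
  classical
  induction s using Finset.induction_on generalizing f with
  | empty =>
    have : f = 0 := by ext m; simpa using hf m
    simp [this]
  | insert a s ha ih =>
    let h : MvPowerSeries σ R := fun m => if m a = 0 then coeff m f else 0
    have hh (m : σ →₀ ℕ) : coeff m h = if m a = 0 then coeff m f else 0 := rfl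
    have hmem : h ∈ Ideal.span ((X : σ → MvPowerSeries σ R) '' s) := by
      refine ih h fun m hm => ?_
      rw [hh]
      split_ifs with hma
      · exact hf m (by simpa [hma] using hm)
      · rfl
    have hdvd : X a ∣ f - h := X_dvd_iff.2 fun m hm => by simp [hh, hm]
    rw [← sub_add_cancel f h]
    refine add_mem (Ideal.mem_of_dvd _ hdvd (Ideal.subset_span ⟨a, by simp, rfl⟩)) ?_
    exact Ideal.span_mono (Set.image_mono (by simp)) hmem

theorem exists_eq_sum_mul_X {σ R : Type*} [Fintype σ] [CommRing R] (f : MvPowerSeries σ R)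
    (hf : constantCoeff f = 0) : ∃ g : σ → MvPowerSeries σ R, f = ∑ i, g i * X i := by
  have h := mem_span_image_X Finset.univ f fun m hm => by
    have : m = 0 := Finsupp.ext fun i => hm i (Finset.mem_univ i)
    simpa [this] using hf
  rw [Finset.coe_univ, Set.image_univ, Ideal.mem_span_range_iff_exists_fun] at h
  exact h.imp fun _ => Eq.symm

theorem coeff_single_one_mul {σ R : Type*} [CommRing R] (f g : MvPowerSeries σ R) (i : σ) :
    coeff (Finsupp.single i 1) (f * g) =
      constantCoeff f * coeff (Finsupp.single i 1) g +
        coeff (Finsupp.single i 1) f * constantCoeff g := by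
  classical
  simp [coeff_mul, Finsupp.antidiagonal_single, Finset.Nat.antidiagonal_succ]

/-- The matrix of linear parts of a surjective endomorphism is invertible. -/
theorem isUnit_det_linearPart {σ K : Type*} [Fintype σ] [DecidableEq σ] [Field K]
    (ψ : MvPowerSeries σ K →+* MvPowerSeries σ K) (hψ : Function.Surjective ψ)
    (h0 : ∀ i, constantCoeff (ψ (X i)) = 0) :
    IsUnit (Matrix.of fun i j => coeff (Finsupp.single j 1) (ψ (X i))).det := by
  have key (j : σ) : ∃ c : σ → K, ∀ l, ∑ i, c i * coeff (Finsupp.single l 1) (ψ (X i)) =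
      coeff (Finsupp.single l 1) (X j : MvPowerSeries σ K) := by
    obtain ⟨f, hf⟩ := hψ (X j)
    have hf0 : constantCoeff f = 0 := by
      by_contra hne
      have hu := (isUnit_iff_constantCoeff.2 (isUnit_iff_ne_zero.2 hne)).map ψ
      rw [hf, isUnit_iff_constantCoeff] at hu
      simp at hu
    obtain ⟨g, rfl⟩ := exists_eq_sum_mul_X f hf0
    refine ⟨fun i => constantCoeff (ψ (g i)), fun l => ?_⟩
    rw [← hf]
    simp [coeff_single_one_mul, h0]
  choose c hc using key
  refine Matrix.isUnit_det_of_left_inverse (B := Matrix.of c) ?_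
  ext j l
  simp [Matrix.mul_apply, hc, coeff_index_single_X, Matrix.one_apply, eq_comm]

end MvPowerSeries

theorem PowerSeries.surjective_constantCoeff_comp_C {R : Type*} [CommRing R]
    (φ : PowerSeries R →+* PowerSeries R) (hφ : Function.Surjective φ) (hX : φ X = X) :
    Function.Surjective (constantCoeff.comp (φ.comp C)) := by
  intro g
  obtain ⟨a, ha⟩ := hφ (C g)
  refine ⟨constantCoeff a, ?_⟩
  rw [eq_X_mul_shift_add_const a, map_add, map_mul, hX] at ha
  simpa using congrArg constantCoeff ha


/-- **Sufficient condition for a formal isotopy to be evaluative (unweighted).**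
Let `K` be a field of characteristic zero, `R = MvPowerSeries (Fin n) K`, and `φ` a
formal isotopy with components `φ^{k,i} = coeff_k (φ (C x^i))`.  If `Θ(φ^{k,i}) ≥ 2`
for all `k ≥ 1` and the orders of the `φ^{k,·}` tend to infinity, then `φ` is
evaluative: each `x^α`-coefficient of each component is nonzero for only finitely many
`k`, each component has vanishing constant coefficient, and the polynomial matrix of
linear parts has determinant a nonzero constant polynomial. -/
theorem evaluative_isotopy_condition
    (K : Type*) [Field K] [CharZero K] (n : ℕ)
    (φ : PowerSeries (MvPowerSeries (Fin n) K) ≃ₐ[K]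
          PowerSeries (MvPowerSeries (Fin n) K))
    (hφX : φ PowerSeries.X = PowerSeries.X)
    (comp : ℕ → Fin n → MvPowerSeries (Fin n) K)
    (hcomp : ∀ (k : ℕ) (i : Fin n), comp k i =
      PowerSeries.coeff k
        (φ (PowerSeries.C (MvPowerSeries.X i))))
    (h1 : ∀ k : ℕ, 1 ≤ k → ∀ (i : Fin n) (α : Fin n →₀ ℕ),
      (∑ j, α j) ≤ 1 → MvPowerSeries.coeff α (comp k i) = 0)
    (hlim : ∀ N : ℕ, ∃ K₀ : ℕ, ∀ k : ℕ, K₀ ≤ k → ∀ (i : Fin n) (α : Fin n →₀ ℕ),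
      (∑ j, α j) < N → MvPowerSeries.coeff α (comp k i) = 0) :
    (∀ (i : Fin n) (α : Fin n →₀ ℕ),
      {k : ℕ | MvPowerSeries.coeff α (comp k i) ≠ 0}.Finite) ∧
    (∀ (k : ℕ) (i : Fin n), MvPowerSeries.constantCoeff (comp k i) = 0) ∧
    (∃ p : Matrix (Fin n) (Fin n) (Polynomial K),
      (∀ (i j : Fin n) (k : ℕ),
        (p i j).coeff k = MvPowerSeries.coeff (Finsupp.single j 1) (comp k i)) ∧
      ∃ c : K, c ≠ 0 ∧ p.det = Polynomial.C c) := by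
  let ψ : MvPowerSeries (Fin n) K →+* MvPowerSeries (Fin n) K :=
    PowerSeries.constantCoeff.comp ((φ : _ →+* _).comp PowerSeries.C)
  have hψ : Function.Surjective ψ :=
    PowerSeries.surjective_constantCoeff_comp_C _ φ.surjective hφX
  have hψX (i : Fin n) : ψ (MvPowerSeries.X i) = comp 0 i := by
    simp [ψ, hcomp]
  have hψ0 (i : Fin n) : MvPowerSeries.constantCoeff (ψ (MvPowerSeries.X i)) = 0 := by
    have := IsLocalHom.of_surjective ψ hψ
    by_contra hne
    have hu := isUnit_of_map_unit ψ _
      (MvPowerSeries.isUnit_iff_constantCoeff.2 (isUnit_iff_ne_zero.2 hne))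
    rw [MvPowerSeries.isUnit_iff_constantCoeff] at hu
    simp at hu
  refine ⟨fun i α => ?_, fun k i => ?_, ?_⟩
  · obtain ⟨K₀, hK₀⟩ := hlim (∑ j, α j + 1)
    refine (Set.finite_lt_nat K₀).subset fun k hk => ?_
    by_contra hlt
    exact hk (hK₀ k (not_lt.1 hlt) i α (Nat.lt_succ_self _))
  · rcases Nat.eq_zero_or_pos k with rfl | hk
    · rw [← hψX, hψ0]
    · simpa using h1 k hk i 0 (by simp)
  · refine ⟨(Matrix.of fun i j => MvPowerSeries.coeff (Finsupp.single j 1)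
      (ψ (MvPowerSeries.X i))).map Polynomial.C, fun i j k => ?_, _,
      (MvPowerSeries.isUnit_det_linearPart ψ hψ hψ0).ne_zero, ?_⟩
    · rcases Nat.eq_zero_or_pos k with rfl | hk
      · simp [hψX]
      · rw [h1 k hk i _ (by simp [Finsupp.single_apply])]
        simp [Polynomial.coeff_C, hk.ne']
    · exact (RingHom.map_det Polynomial.C _).symm
end

section
/- Let K be a field of characteristic zero, R = MvPowerSeries (Fin n) K, and D a time-dependent formal vector field with components X^{k,i} := coeff_k(D(C(x^i))) ∈ R. Suppose that for all k ∈ ℕ and all i, coeff_α(X^{k,i}) = 0 whenever |α| < k + 2. Let φ be a formal isotopy satisfying the initial condition (IC) and the flow property (FP) for D, with components φ^{k,i} := coeff_k(φ(C(x^i))). Then for all k ∈ ℕ and all i, coeff_α(φ^{k,i}) = 0 whenever |α| < k + 1. -/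
namespace MvPowerSeries

/-- The ideal of power series of order at least `r`. -/
def orderIdeal (σ R : Type*) [CommRing R] (r : ℕ) : Ideal (MvPowerSeries σ R) where
  carrier := {f | (r : ℕ∞) ≤ f.order}
  add_mem' ha hb := (le_min ha hb).trans min_order_le_add
  zero_mem' := by simp
  smul_mem' _ _ hf := (le_add_left hf).trans le_order_mul

section CommRing

variable {σ R : Type*} [CommRing R]

theorem mem_orderIdeal {r : ℕ} {f : MvPowerSeries σ R} :
    f ∈ orderIdeal σ R r ↔ (r : ℕ∞) ≤ f.order := Iff.rfl

theorem mem_orderIdeal_iff_coeff {r : ℕ} {f : MvPowerSeries σ R} :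
    f ∈ orderIdeal σ R r ↔ ∀ α : σ →₀ ℕ, α.degree < r → coeff α f = 0 :=
  ⟨fun h _ hα => coeff_of_lt_order (lt_of_lt_of_le (by exact_mod_cast hα) (mem_orderIdeal.1 h)),
    fun h => mem_orderIdeal.2 (nat_le_order h)⟩

theorem orderIdeal_anti {r s : ℕ} (h : r ≤ s) : orderIdeal σ R s ≤ orderIdeal σ R r :=
  fun _ hf => (Nat.cast_le.2 h).trans (mem_orderIdeal.1 hf)

theorem mul_mem_orderIdeal {r s : ℕ} {f g : MvPowerSeries σ R}
    (hf : f ∈ orderIdeal σ R r) (hg : g ∈ orderIdeal σ R s) :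
    f * g ∈ orderIdeal σ R (r + s) := by
  rw [mem_orderIdeal] at *
  push_cast
  exact (add_le_add hf hg).trans le_order_mul

theorem X_mem_orderIdeal_one (i : σ) : (X i : MvPowerSeries σ R) ∈ orderIdeal σ R 1 := by
  rw [mem_orderIdeal, Nat.cast_one, one_le_order_iff_constCoeff_eq_zero, constantCoeff_X]

end CommRing

variable {σ K : Type*} [Fintype σ] [Field K] [CharZero K]

/-- Euler's identity splits a power series along the variables, lowering the order by one. -/
theorem exists_eq_C_add_sum_X_mul (f : MvPowerSeries σ K) :
    ∃ g : σ → MvPowerSeries σ K, f = C (constantCoeff f) + ∑ i, X i * g i ∧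
      ∀ r, f ∈ orderIdeal σ K r → ∀ i, g i ∈ orderIdeal σ K (r - 1) := by
  classical
  obtain ⟨g, hg⟩ : ∃ g : σ → MvPowerSeries σ K, ∀ i β, coeff β (g i) =
      ((β i : K) + 1) / ((β.degree : K) + 1) * coeff (β + Finsupp.single i 1) f :=
    ⟨fun i β => ((β i : K) + 1) / ((β.degree : K) + 1) * coeff (β + Finsupp.single i 1) f,
      fun _ _ => rfl⟩
  refine ⟨g, ?_, fun r hf i => ?_⟩
  · ext α
    have key (i : σ) : coeff α (X i * g i) = (α i : K) / (α.degree : K) * coeff α f := by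
      rw [X_def, coeff_monomial_mul]
      split_ifs with h
      · obtain ⟨β, rfl⟩ := exists_add_of_le h
        rw [add_tsub_cancel_left, one_mul, hg, add_comm β]
        simp [add_comm]
      · have : α i = 0 := by
          by_contra h0
          exact h (Finsupp.single_le_iff.2 (Nat.one_le_iff_ne_zero.2 h0))
        simp [this]
    rw [map_add, map_sum, coeff_C]
    simp_rw [key]
    rw [← Finset.sum_mul, ← Finset.sum_div, ← Nat.cast_sum, ← Finsupp.degree_eq_sum]
    split_ifs with h
    · simp [h]
    · have : (α.degree : K) ≠ 0 := by
        exact_mod_cast (Finsupp.degree_eq_zero_iff α).not.2 h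
      rw [div_self this, one_mul, zero_add]
  · rw [mem_orderIdeal_iff_coeff] at hf ⊢
    intro β hβ
    have : coeff (β + Finsupp.single i 1) f = 0 := hf _ (by simp; omega)
    rw [hg, this, mul_zero]

theorem derivation_mem_orderIdeal (E : Derivation K (MvPowerSeries σ K) (MvPowerSeries σ K))
    {s : ℕ} (hE : ∀ i, E (X i) ∈ orderIdeal σ K (s + 1)) {r : ℕ} {f : MvPowerSeries σ K}
    (hf : f ∈ orderIdeal σ K r) : E f ∈ orderIdeal σ K (r + s) := by
  suffices H : ∀ N r f, f ∈ orderIdeal σ K r → E f ∈ orderIdeal σ K (min N (r + s)) by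
    simpa using H (r + s) r f hf
  intro N
  induction N with
  | zero => intro r f _; simp [mem_orderIdeal]
  | succ N ih =>
    intro r f hf
    obtain ⟨g, hfg, hg⟩ := exists_eq_C_add_sum_X_mul f
    have hC : E (C (constantCoeff f)) = 0 := E.map_algebraMap (constantCoeff f)
    rw [hfg, map_add, hC, zero_add, map_sum]
    refine sum_mem fun i _ => ?_
    rw [E.leibniz, smul_eq_mul, smul_eq_mul]
    exact add_mem
      (orderIdeal_anti (by omega) (mul_mem_orderIdeal (X_mem_orderIdeal_one i) (ih _ _ (hg r hf i))))
      (orderIdeal_anti (by omega) (mul_mem_orderIdeal (hg r hf i) (hE i)))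

end MvPowerSeries

namespace PowerSeries

/-- The `k`-th coefficient of a derivation of `R⟦X⟧`, restricted to the constants `R`. -/
noncomputable def coeffDerivation {K R : Type*} [CommRing K] [CommRing R] [Algebra K R]
    (D : Derivation K (PowerSeries R) (PowerSeries R)) (k : ℕ) : Derivation K R R :=
  Derivation.mk'
    { toFun := fun f => coeff k (D (C f))
      map_add' := fun f g => by simp
      map_smul' := fun c f => by
        have : (C (c • f) : PowerSeries R) = c • C f := by
          ext m
          simp only [coeff_smul, coeff_C]
          split_ifs <;> simp
        simp [this] }
    fun f g => by simp

open MvPowerSeries in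
theorem coeff_map_mem_orderIdeal {σ K : Type*} [Field K]
    (φ : PowerSeries (MvPowerSeries σ K) ≃ₐ[K] PowerSeries (MvPowerSeries σ K))
    (hφX : φ PowerSeries.X = PowerSeries.X) {k : ℕ}
    (hφ : ∀ m ≤ k, ∀ r f, f ∈ orderIdeal σ K r →
      PowerSeries.coeff m (φ (PowerSeries.C f)) ∈ orderIdeal σ K (r + m))
    {r : ℕ} {F : PowerSeries (MvPowerSeries σ K)}
    (hF : ∀ j, PowerSeries.coeff j F ∈ orderIdeal σ K (r + j)) :
    PowerSeries.coeff k (φ F) ∈ orderIdeal σ K (r + k) := by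
  induction k generalizing r F with
  | zero =>
    rw [PowerSeries.eq_X_mul_shift_add_const F, map_add, map_mul, hφX, map_add,
      PowerSeries.coeff_zero_X_mul, zero_add]
    exact hφ 0 le_rfl r _ (by simpa using hF 0)
  | succ k ih =>
    rw [PowerSeries.eq_X_mul_shift_add_const F, map_add, map_mul, hφX, map_add,
      PowerSeries.coeff_succ_X_mul]
    refine add_mem ?_ (hφ (k + 1) le_rfl r _ (by simpa using hF 0))
    have := ih (fun m hm => hφ m (by omega)) (r := r + 1)
      (F := PowerSeries.mk fun p => PowerSeries.coeff (p + 1) F) fun j => by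
        rw [PowerSeries.coeff_mk, add_assoc, add_comm 1 j]
        exact hF (j + 1)
    rwa [add_assoc, add_comm 1 k] at this

end PowerSeries

/-- **Order estimate for flows (unweighted).**
Let `K` be a field of characteristic zero, `R = MvPowerSeries (Fin n) K`, and `D` a
time-dependent formal vector field whose `k`-th Taylor components
`X^{k,i} = coeff_k (D (C x^i))` satisfy `Θ(X^{k,i}) ≥ k + 2` for all `k, i`.  If `φ` is
a formal isotopy satisfying the initial condition and flow property for `D`, then its
components `φ^{k,i} = coeff_k (φ (C x^i))` satisfy `Θ(φ^{k,i}) ≥ k + 1`. -/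
theorem evaluative_flow_condition
    (K : Type*) [Field K] [CharZero K] (n : ℕ)
    (D : Derivation K (PowerSeries (MvPowerSeries (Fin n) K))
          (PowerSeries (MvPowerSeries (Fin n) K)))
    (hD : D PowerSeries.X = 0)
    (hDord : ∀ (k : ℕ) (i : Fin n) (α : Fin n →₀ ℕ),
      (∑ j, α j) < k + 2 →
      MvPowerSeries.coeff (R := K) α
        (PowerSeries.coeff (R := MvPowerSeries (Fin n) K) k
          (D (PowerSeries.C (R := MvPowerSeries (Fin n) K) (MvPowerSeries.X i)))) = 0)
    (φ : PowerSeries (MvPowerSeries (Fin n) K) ≃ₐ[K]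
          PowerSeries (MvPowerSeries (Fin n) K))
    (hφX : φ PowerSeries.X = PowerSeries.X)
    (hIC : ∀ f : MvPowerSeries (Fin n) K,
      PowerSeries.coeff (R := MvPowerSeries (Fin n) K) 0
        (φ (PowerSeries.C (R := MvPowerSeries (Fin n) K) f)) = f)
    (hFP : ∀ f : MvPowerSeries (Fin n) K,
      PowerSeries.derivative (MvPowerSeries (Fin n) K)
          (φ (PowerSeries.C (R := MvPowerSeries (Fin n) K) f)) =
        φ (D (PowerSeries.C (R := MvPowerSeries (Fin n) K) f))) :
    ∀ (k : ℕ) (i : Fin n) (α : Fin n →₀ ℕ),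
      (∑ j, α j) < k + 1 →
      MvPowerSeries.coeff (R := K) α
        (PowerSeries.coeff (R := MvPowerSeries (Fin n) K) k
          (φ (PowerSeries.C (R := MvPowerSeries (Fin n) K) (MvPowerSeries.X i)))) = 0 := by
  have hcomp (j : ℕ) {r : ℕ} {f : MvPowerSeries (Fin n) K}
      (hf : f ∈ MvPowerSeries.orderIdeal (Fin n) K r) :
      PowerSeries.coeff j (D (PowerSeries.C f)) ∈
        MvPowerSeries.orderIdeal (Fin n) K (r + (j + 1)) :=
    MvPowerSeries.derivation_mem_orderIdeal (PowerSeries.coeffDerivation D j)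
      (fun i => MvPowerSeries.mem_orderIdeal_iff_coeff.2 fun α hα =>
        hDord j i α (by rwa [← Finsupp.degree_eq_sum])) hf
  have hflow (k : ℕ) : ∀ r f, f ∈ MvPowerSeries.orderIdeal (Fin n) K r →
      PowerSeries.coeff k (φ (PowerSeries.C f)) ∈
        MvPowerSeries.orderIdeal (Fin n) K (r + k) := by
    induction k using Nat.strong_induction_on with
    | _ k ih =>
      intro r f hf
      cases k with
      | zero => rwa [hIC, add_zero]
      | succ k =>
        have h := PowerSeries.coeff_map_mem_orderIdeal φ hφX (k := k) (r := r + 1)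
          (fun m hm => ih m (by omega)) (F := D (PowerSeries.C f)) fun j => by
            rw [add_assoc, add_comm 1 j]
            exact hcomp j hf
        rw [← hFP, PowerSeries.coeff_derivative, add_assoc, add_comm 1 k,
          MvPowerSeries.mem_orderIdeal_iff_coeff] at h
        rw [MvPowerSeries.mem_orderIdeal_iff_coeff]
        intro α hα
        have hk : ((k : MvPowerSeries (Fin n) K) + 1) = MvPowerSeries.C ((k : K) + 1) := by simp
        have := h α hα
        rw [hk, MvPowerSeries.coeff_mul_C] at this
        exact (mul_eq_zero.1 this).resolve_right (Nat.cast_add_one_ne_zero k)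
  intro k i α hα
  refine MvPowerSeries.mem_orderIdeal_iff_coeff.1
    (hflow k 1 _ (MvPowerSeries.X_mem_orderIdeal_one i)) α ?_
  rwa [Finsupp.degree_eq_sum, add_comm]
end
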